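/- Let n ≥ 1, let E and F be Köthe sequence spaces, let α ∈ ℂ^ℕ and C ≥ 0. Then the following are equivalent: (a) α·x_1⋯x_n ∈ F^× and ‖α·x_1⋯x_n‖_{F^×} ≤ C·‖x_1‖_E⋯‖x_n‖_E for all x_1,…,x_n ∈ E; (b) for every β ∈ F and all x_1,…,x_n ∈ E the series ∑_k α(k)·β(k)·x_1(k)⋯x_n(k) converges absolutely and |∑_k α(k)·β(k)·x_1(k)⋯x_n(k)| ≤ C·‖β‖_F·‖x_1‖_E⋯‖x_n‖_E. Consequently the operator norm of the diagonal n-linear operator E × ⋯ × E → F^× associated with α equals sup over β in the closed unit ball of F of the norm of the diagonal n-linear form on E associated with the pointwise product α·β. (This is the isometric identity ℓ_n(𝓛;E,F^×) = M(F, ℓ_n(𝓛;E)).) -/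

import Mathlib

/-- A Köthe sequence space: a linear subspace of `ℂ^ℕ` with a complete norm such that
`ℓ₁ ⊆ E ⊆ ℓ_∞` with inclusions of norm at most 1, and which is normal. -/
structure KotheSpace : Type where
  Mem : (ℕ → ℂ) → Prop
  nrm : (ℕ → ℂ) → ℝ
  mem_zero : Mem 0
  mem_add : ∀ {x y : ℕ → ℂ}, Mem x → Mem y → Mem (x + y)
  mem_smul : ∀ (c : ℂ) {x : ℕ → ℂ}, Mem x → Mem (c • x)
  nrm_add_le : ∀ {x y : ℕ → ℂ}, Mem x → Mem y → nrm (x + y) ≤ nrm x + nrm y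
  nrm_smul : ∀ (c : ℂ) {x : ℕ → ℂ}, Mem x → nrm (c • x) = ‖c‖ * nrm x
  nrm_eq_zero_iff : ∀ {x : ℕ → ℂ}, Mem x → (nrm x = 0 ↔ x = 0)
  l1_mem : ∀ {x : ℕ → ℂ}, Summable (fun k => ‖x k‖) → Mem x
  nrm_le_l1 : ∀ {x : ℕ → ℂ}, Summable (fun k => ‖x k‖) → nrm x ≤ ∑' k, ‖x k‖
  coord_le_nrm : ∀ {x : ℕ → ℂ}, Mem x → ∀ k, ‖x k‖ ≤ nrm x
  normal_mem : ∀ {x y : ℕ → ℂ}, Mem y → (∀ k, ‖x k‖ ≤ ‖y k‖) → Mem x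
  normal_nrm : ∀ {x y : ℕ → ℂ}, Mem x → Mem y → (∀ k, ‖x k‖ ≤ ‖y k‖) → nrm x ≤ nrm y
  complete : ∀ f : ℕ → ℕ → ℂ, (∀ i, Mem (f i)) →
    (∀ ε : ℝ, 0 < ε → ∃ N, ∀ i, N ≤ i → ∀ j, N ≤ j → nrm (f i - f j) < ε) →
    ∃ g, Mem g ∧ ∀ ε : ℝ, 0 < ε → ∃ N, ∀ i, N ≤ i → nrm (f i - g) < ε

namespace KotheSpace

/-- Membership in the Köthe dual `E^×`. -/
def dualMem (E : KotheSpace) (z : ℕ → ℂ) : Prop :=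
  ∀ x, E.Mem x → Summable fun k => ‖z k * x k‖

/-- The norm of the Köthe dual `E^×`. -/
noncomputable def dualNrm (E : KotheSpace) (z : ℕ → ℂ) : ℝ :=
  sSup {r | ∃ x, E.Mem x ∧ E.nrm x ≤ 1 ∧ r = ∑' k, ‖z k * x k‖}

/-- Membership in the Köthe bidual `E^××`. -/
def bidualMem (E : KotheSpace) (z : ℕ → ℂ) : Prop :=
  ∀ w, E.dualMem w → Summable fun k => ‖z k * w k‖

/-- The norm of the Köthe bidual `E^××`. -/
noncomputable def bidualNrm (E : KotheSpace) (z : ℕ → ℂ) : ℝ :=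
  sSup {r | ∃ w, E.dualMem w ∧ E.dualNrm w ≤ 1 ∧ r = ∑' k, ‖z k * w k‖}

end KotheSpace

open scoped BigOperators

namespace KotheSpace

theorem nrm_nonneg (E : KotheSpace) {x : ℕ → ℂ} (hx : E.Mem x) : 0 ≤ E.nrm x :=
  (norm_nonneg (x 0)).trans (E.coord_le_nrm hx 0)

theorem mem_sub (E : KotheSpace) {x y : ℕ → ℂ} (hx : E.Mem x) (hy : E.Mem y) :
    E.Mem (x - y) := by
  have h := E.mem_add hx (E.mem_smul (-1) hy)
  rwa [neg_one_smul, ← sub_eq_add_neg] at h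

theorem nrm_zero (E : KotheSpace) : E.nrm 0 = 0 := (E.nrm_eq_zero_iff E.mem_zero).2 rfl

theorem nrm_sub_comm (E : KotheSpace) {x y : ℕ → ℂ} (hx : E.Mem x) (hy : E.Mem y) :
    E.nrm (x - y) = E.nrm (y - x) := by
  have h := E.nrm_smul (-1) (E.mem_sub hy hx)
  simpa using h

theorem mem_sum (E : KotheSpace) {ι : Type*} (s : Finset ι) (f : ι → ℕ → ℂ)
    (hf : ∀ i, E.Mem (f i)) : E.Mem (∑ i ∈ s, f i) :=
  Finset.sum_induction f E.Mem (fun _ _ => E.mem_add) E.mem_zero fun i _ => hf i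

theorem nrm_sum_le (E : KotheSpace) {ι : Type*} (s : Finset ι) (f : ι → ℕ → ℂ)
    (hf : ∀ i, E.Mem (f i)) : E.nrm (∑ i ∈ s, f i) ≤ ∑ i ∈ s, E.nrm (f i) := by
  classical
  induction s using Finset.induction_on with
  | empty => simp [E.nrm_zero]
  | insert a s ha ih =>
    rw [Finset.sum_insert ha, Finset.sum_insert ha]
    exact (E.nrm_add_le (hf a) (E.mem_sum s f hf)).trans (by gcongr)

/-- An absolutely convergent series in a Köthe space converges, coordinatewise, to an element of
the space. -/
theorem exists_mem_hasSum (E : KotheSpace) (f : ℕ → ℕ → ℂ) (hf : ∀ i, E.Mem (f i))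
    (hs : Summable fun i => E.nrm (f i)) :
    ∃ g, E.Mem g ∧ ∀ k, Filter.Tendsto (fun n => ∑ i ∈ Finset.range n, f i k)
      Filter.atTop (nhds (g k)) := by
  have hmem (n : ℕ) : E.Mem (∑ i ∈ Finset.range n, f i) := E.mem_sum _ f hf
  have hdist {m n : ℕ} (hmn : m ≤ n) :
      E.nrm (∑ i ∈ Finset.range n, f i - ∑ i ∈ Finset.range m, f i) ≤
        |∑ i ∈ Finset.range n, E.nrm (f i) - ∑ i ∈ Finset.range m, E.nrm (f i)| := by
    rw [← Finset.sum_Ico_eq_sub _ hmn, ← Finset.sum_Ico_eq_sub _ hmn]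
    exact (E.nrm_sum_le _ f hf).trans (le_abs_self _)
  obtain ⟨g, hg, hlim⟩ := E.complete (fun n => ∑ i ∈ Finset.range n, f i) hmem (by
    intro ε hε
    obtain ⟨N, hN⟩ := Metric.cauchySeq_iff.1 hs.hasSum.tendsto_sum_nat.cauchySeq ε hε
    refine ⟨N, fun i hi j hj => ?_⟩
    rcases le_total j i with h | h
    · exact (hdist h).trans_lt (hN i hi j hj)
    · rw [E.nrm_sub_comm (hmem i) (hmem j)]
      exact (hdist h).trans_lt (hN j hj i hi))
  refine ⟨g, hg, fun k => Metric.tendsto_atTop.2 fun ε hε => ?_⟩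
  obtain ⟨N, hN⟩ := hlim ε hε
  refine ⟨N, fun n hn => ?_⟩
  have h := (E.coord_le_nrm (E.mem_sub (hmem n) hg) k).trans_lt (hN n hn)
  simpa [dist_eq_norm, Finset.sum_apply] using h

/-- The supremum defining the Köthe dual norm is finite. -/
theorem bddAbove_of_dualMem (E : KotheSpace) {z : ℕ → ℂ} (hz : E.dualMem z) :
    BddAbove {r | ∃ x, E.Mem x ∧ E.nrm x ≤ 1 ∧ r = ∑' k, ‖z k * x k‖} := by
  by_contra hb
  rw [not_bddAbove_iff] at hb
  have hex (j : ℕ) : ∃ x, E.Mem x ∧ E.nrm x ≤ 1 ∧ (4 : ℝ) ^ j < ∑' k, ‖z k * x k‖ := by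
    obtain ⟨_, ⟨x, hx, hx1, rfl⟩, h⟩ := hb (4 ^ j)
    exact ⟨x, hx, hx1, h⟩
  choose x hx hx1 hlarge using hex
  set f : ℕ → ℕ → ℂ := fun j k => (((1 / 2 : ℝ) ^ j * ‖x j k‖ : ℝ) : ℂ) with hfdef
  have hfnorm (j k : ℕ) : ‖f j k‖ = (1 / 2 : ℝ) ^ j * ‖x j k‖ := by
    rw [hfdef, Complex.norm_real, Real.norm_of_nonneg (by positivity)]
  have hle (j k : ℕ) : ‖f j k‖ ≤ ‖(((1 / 2 : ℂ) ^ j) • x j) k‖ := by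
    rw [hfnorm]; simp
  have hfmem (j : ℕ) : E.Mem (f j) := E.normal_mem (E.mem_smul _ (hx j)) (hle j)
  have hfnrm (j : ℕ) : E.nrm (f j) ≤ (1 / 2 : ℝ) ^ j := by
    refine (E.normal_nrm (hfmem j) (E.mem_smul _ (hx j)) (hle j)).trans ?_
    rw [E.nrm_smul _ (hx j)]
    have h : ‖(1 / 2 : ℂ) ^ j‖ = (1 / 2 : ℝ) ^ j := by simp
    rw [h]
    exact mul_le_of_le_one_right (by positivity) (hx1 j)
  obtain ⟨g, hg, hlim⟩ := E.exists_mem_hasSum f hfmem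
    (Summable.of_nonneg_of_le (fun j => E.nrm_nonneg (hfmem j)) hfnrm
      (summable_geometric_of_lt_one (by norm_num) (by norm_num)))
  have hdom (j k : ℕ) : (1 / 2 : ℝ) ^ j * ‖x j k‖ ≤ ‖g k‖ := by
    refine ge_of_tendsto (hlim k).norm (Filter.eventually_atTop.2 ⟨j + 1, fun n hn => ?_⟩)
    have hsum : ∑ i ∈ Finset.range n, f i k =
        ((∑ i ∈ Finset.range n, (1 / 2 : ℝ) ^ i * ‖x i k‖ : ℝ) : ℂ) := by
      rw [Complex.ofReal_sum]
    rw [hsum, Complex.norm_real]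
    exact (Finset.single_le_sum (f := fun i => (1 / 2 : ℝ) ^ i * ‖x i k‖)
      (fun i _ => by positivity) (Finset.mem_range.2 hn)).trans (le_abs_self _)
  have hbound (j : ℕ) : (2 : ℝ) ^ j ≤ ∑' k, ‖z k * g k‖ := by
    calc (2 : ℝ) ^ j = (1 / 2) ^ j * 4 ^ j := by rw [← mul_pow]; norm_num
      _ ≤ (1 / 2) ^ j * ∑' k, ‖z k * x j k‖ := by gcongr; exact (hlarge j).le
      _ = ∑' k, (1 / 2) ^ j * ‖z k * x j k‖ := tsum_mul_left.symm
      _ ≤ ∑' k, ‖z k * g k‖ := by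
        refine ((hz _ (hx j)).mul_left _).tsum_le_tsum (fun k => ?_) (hz g hg)
        rw [norm_mul, norm_mul, mul_left_comm]
        gcongr
        exact hdom j k
  obtain ⟨j, hj⟩ := pow_unbounded_of_one_lt (∑' k, ‖z k * g k‖) (one_lt_two : (1 : ℝ) < 2)
  exact (hbound j).not_gt hj

/-- Hölder's inequality for a Köthe space and its dual. -/
theorem tsum_norm_mul_le (E : KotheSpace) {z x : ℕ → ℂ} (hz : E.dualMem z) (hx : E.Mem x) :
    ∑' k, ‖z k * x k‖ ≤ E.dualNrm z * E.nrm x := by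
  rcases (E.nrm_nonneg hx).eq_or_lt with h0 | hpos
  · obtain rfl := (E.nrm_eq_zero_iff hx).1 h0.symm
    simp [E.nrm_zero]
  · have hnorm : ‖((E.nrm x)⁻¹ : ℂ)‖ = (E.nrm x)⁻¹ := by
      rw [norm_inv, Complex.norm_real, Real.norm_of_nonneg hpos.le]
    have hle := le_csSup (E.bddAbove_of_dualMem hz)
      ⟨((E.nrm x)⁻¹ : ℂ) • x, E.mem_smul _ hx,
        by rw [E.nrm_smul _ hx, hnorm, inv_mul_cancel₀ hpos.ne'], rfl⟩
    have heq : ∑' k, ‖z k * (((E.nrm x)⁻¹ : ℂ) • x) k‖ =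
        (E.nrm x)⁻¹ * ∑' k, ‖z k * x k‖ := by
      rw [← tsum_mul_left]
      refine tsum_congr fun k => ?_
      rw [Pi.smul_apply, smul_eq_mul, mul_left_comm, norm_mul, hnorm]
    rw [heq, inv_mul_le_iff₀ hpos, mul_comm] at hle
    exact hle

/-- The dual norm of `z` is at most `B` if `|∑ z x| ≤ B` on the unit ball. -/
theorem dualNrm_le (E : KotheSpace) {z : ℕ → ℂ} {B : ℝ} (hB : 0 ≤ B)
    (h : ∀ x, E.Mem x → E.nrm x ≤ 1 → ‖∑' k, z k * x k‖ ≤ B) : E.dualNrm z ≤ B := by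
  refine Real.sSup_le ?_ hB
  rintro _ ⟨x, hx, hx1, rfl⟩
  -- Rotate the coordinates of `x` so that every product `z k * y k` is nonnegative.
  have hphase (k : ℕ) : ∃ w : ℂ, ‖w‖ ≤ ‖x k‖ ∧ z k * w = (‖z k * x k‖ : ℝ) := by
    obtain ⟨c, hc, hcz⟩ := RCLike.exists_norm_eq_mul_self (z k * x k)
    refine ⟨c * x k, by simp [hc], ?_⟩
    rw [mul_left_comm]
    exact hcz.symm
  choose y hy hzy using hphase
  have hym : E.Mem y := E.normal_mem hx hy
  have hle := h y hym ((E.normal_nrm hym hx hy).trans hx1)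
  simp_rw [hzy] at hle
  rw [← Complex.ofReal_tsum, Complex.norm_real] at hle
  exact (le_abs_self _).trans hle

end KotheSpace

/-- The isometric identity `ℓ_n(𝓛; E, F^×) = M(F, ℓ_n(𝓛; E))`: the diagonal `n`-linear
operator associated with `α` maps `E × ⋯ × E` into `F^×` with norm bound `C` iff for every
`β ∈ F` the diagonal `n`-linear form associated with `α·β` has norm at most `C·‖β‖_F`. -/
theorem diag_into_dual_iff_multiplier (n : ℕ) (hn : 1 ≤ n) (E F : KotheSpace) (α : ℕ → ℂ)
    (C : ℝ) (hC : 0 ≤ C) :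
    (∀ x : Fin n → ℕ → ℂ, (∀ i, E.Mem (x i)) →
        F.dualMem (fun k => α k * ∏ i, x i k) ∧
        F.dualNrm (fun k => α k * ∏ i, x i k) ≤ C * ∏ i, E.nrm (x i)) ↔
      (∀ β : ℕ → ℂ, F.Mem β → ∀ x : Fin n → ℕ → ℂ, (∀ i, E.Mem (x i)) →
        Summable (fun k => ‖α k * β k * ∏ i, x i k‖) ∧
        ‖∑' k, α k * β k * ∏ i, x i k‖ ≤ C * F.nrm β * ∏ i, E.nrm (x i)) := by
  constructor
  · intro h β hβ x hx
    obtain ⟨hmem, hle⟩ := h x hx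
    have heq (k : ℕ) : α k * β k * ∏ i, x i k = (α k * ∏ i, x i k) * β k := by ring
    simp_rw [heq]
    refine ⟨hmem β hβ, (norm_tsum_le_tsum_norm (hmem β hβ)).trans
      ((F.tsum_norm_mul_le hmem hβ).trans ?_)⟩
    rw [mul_right_comm]
    exact mul_le_mul_of_nonneg_right hle (F.nrm_nonneg hβ)
  · intro h x hx
    have hprod : 0 ≤ ∏ i, E.nrm (x i) := Finset.prod_nonneg fun i _ => E.nrm_nonneg (hx i)
    have heq (β : ℕ → ℂ) (k : ℕ) :
        (α k * ∏ i, x i k) * β k = α k * β k * ∏ i, x i k := by ring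
    refine ⟨fun β hβ => ?_, F.dualNrm_le (mul_nonneg hC hprod) fun β hβ hβ1 => ?_⟩
    · simp_rw [heq]
      exact (h β hβ x hx).1
    · simp_rw [heq]
      refine (h β hβ x hx).2.trans (mul_le_mul_of_nonneg_right ?_ hprod)
      exact mul_le_of_le_one_right hC hβ1
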